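/- arXiv:1110.5894 — 2 statements merged into one kernel-verified Lean document; each statement's English description precedes it below -/
import Mathlib

section
/- Let Ψ : (0,∞) → [0,∞) be strictly increasing with ∫₀^∞ 1/(1+Ψ(ζ)) dζ < ∞. Then for all ξ₁, ξ₂ > 0 and every z ∈ ℂ with Im z > 0, one has Im φ(ξ₁,z) · Im φ(ξ₂,z) − Im φ(z) · Im φ(ξ₁,ξ₂,z) ≤ 0. -/
open MeasureTheory Filter Topology Set

/-- `φ(z) = (1/π) ∫₀^∞ 1/(Ψ(ζ)+z) dζ`. -/
noncomputable def phi (Ψ : ℝ → ℝ) (z : ℂ) : ℂ :=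
  (Real.pi : ℂ)⁻¹ * ∫ ζ in Ioi (0:ℝ), ((Ψ ζ : ℂ) + z)⁻¹

/-- `φ(ξ,z) = (1/π) ∫₀^∞ (ξ²/(ξ²+ζ²)) / (Ψ(ζ)+z) dζ`. -/
noncomputable def phi1 (Ψ : ℝ → ℝ) (ξ : ℝ) (z : ℂ) : ℂ :=
  (Real.pi : ℂ)⁻¹ * ∫ ζ in Ioi (0:ℝ), ((ξ^2 / (ξ^2 + ζ^2) : ℝ) : ℂ) * ((Ψ ζ : ℂ) + z)⁻¹

/-- `φ(ξ₁,ξ₂,z) = (1/π) ∫₀^∞ (ξ₁²/(ξ₁²+ζ²))(ξ₂²/(ξ₂²+ζ²)) / (Ψ(ζ)+z) dζ`. -/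
noncomputable def phi2 (Ψ : ℝ → ℝ) (ξ₁ ξ₂ : ℝ) (z : ℂ) : ℂ :=
  (Real.pi : ℂ)⁻¹ * ∫ ζ in Ioi (0:ℝ),
    ((ξ₁^2 / (ξ₁^2 + ζ^2) * (ξ₂^2 / (ξ₂^2 + ζ^2)) : ℝ) : ℂ) * ((Ψ ζ : ℂ) + z)⁻¹

theorem integral_sub_sub_add_const_mul {α : Type*} [MeasurableSpace α] {μ : Measure α}
    {f₁ f₂ f₃ f₄ : α → ℝ} (h₁ : Integrable f₁ μ) (h₂ : Integrable f₂ μ) (h₃ : Integrable f₃ μ)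
    (h₄ : Integrable f₄ μ) (c₁ c₂ c₃ c₄ : ℝ) :
    ∫ x, (c₁ * f₁ x - c₂ * f₂ x - c₃ * f₃ x + c₄ * f₄ x) ∂μ =
      c₁ * ∫ x, f₁ x ∂μ - c₂ * ∫ x, f₂ x ∂μ - c₃ * ∫ x, f₃ x ∂μ + c₄ * ∫ x, f₄ x ∂μ := by
  have h₁₂ : Integrable (fun x => c₁ * f₁ x - c₂ * f₂ x) μ := (h₁.const_mul _).sub (h₂.const_mul _)
  have h₁₃ : Integrable (fun x => c₁ * f₁ x - c₂ * f₂ x - c₃ * f₃ x) μ := h₁₂.sub (h₃.const_mul _)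
  rw [integral_add h₁₃ (h₄.const_mul _), integral_sub h₁₂ (h₃.const_mul _),
    integral_sub (h₁.const_mul _) (h₂.const_mul _)]
  simp only [integral_const_mul]

/-- Chebyshev's integral inequality for a nonnegative weight `w` and similarly ordered `f`, `g`. -/
theorem setIntegral_mul_setIntegral_le_of_monovaryOn {α : Type*} [MeasurableSpace α]
    {μ : Measure α} {s : Set α} (hs : MeasurableSet s) {f g w : α → ℝ}
    (hfg : MonovaryOn f g s) (hw₀ : ∀ x ∈ s, 0 ≤ w x) (hw : IntegrableOn w s μ)
    (hfw : IntegrableOn (fun x => f x * w x) s μ) (hgw : IntegrableOn (fun x => g x * w x) s μ)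
    (hfgw : IntegrableOn (fun x => f x * g x * w x) s μ) :
    (∫ x in s, f x * w x ∂μ) * (∫ x in s, g x * w x ∂μ) ≤
      (∫ x in s, w x ∂μ) * ∫ x in s, f x * g x * w x ∂μ := by
  set W := ∫ x in s, w x ∂μ
  set F := ∫ x in s, f x * w x ∂μ
  set G := ∫ x in s, g x * w x ∂μ
  set H := ∫ x in s, f x * g x * w x ∂μ
  have inner_nonneg : ∀ y ∈ s, 0 ≤ H - g y * F - f y * G + f y * g y * W := by
    intro y hy
    have hnn : 0 ≤ ∫ x in s, (1 * (f x * g x * w x) - g y * (f x * w x) - f y * (g x * w x)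
        + f y * g y * w x) ∂μ := by
      refine setIntegral_nonneg hs fun x hx => ?_
      have hx₀ := mul_nonneg (hfg.sub_mul_sub_nonneg hx hy) (hw₀ x hx)
      linarith
    rwa [integral_sub_sub_add_const_mul hfgw hfw hgw hw, one_mul] at hnn
  have hnn : 0 ≤ ∫ y in s, (H * w y - F * (g y * w y) - G * (f y * w y)
      + W * (f y * g y * w y)) ∂μ := by
    refine setIntegral_nonneg hs fun y hy => ?_
    have hy₀ := mul_nonneg (inner_nonneg y hy) (hw₀ y hy)
    linarith
  rw [integral_sub_sub_add_const_mul hw hgw hfw hfgw] at hnn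
  linarith

theorem norm_inv_ofReal_add_le {t : ℝ} (ht : 0 ≤ t) {z : ℂ} (hz : 0 < z.im) :
    ‖((t : ℂ) + z)⁻¹‖ ≤ (1 + ‖1 - z‖ / z.im) * (1 / (1 + t)) := by
  have him : z.im ≤ ‖(t : ℂ) + z‖ := by
    simpa using (le_abs_self _).trans (Complex.abs_im_le_norm ((t : ℂ) + z))
  have hpos : 0 < ‖(t : ℂ) + z‖ := hz.trans_le him
  have htri : 1 + t ≤ ‖(t : ℂ) + z‖ + ‖1 - z‖ := by
    calc 1 + t = ‖((t : ℂ) + z) + (1 - z)‖ := by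
          rw [show (t : ℂ) + z + (1 - z) = ((1 + t : ℝ) : ℂ) by push_cast; ring,
            Complex.norm_real, Real.norm_of_nonneg (by linarith)]
      _ ≤ _ := norm_add_le _ _
  have hsc : ‖1 - z‖ ≤ ‖1 - z‖ / z.im * ‖(t : ℂ) + z‖ := by
    rw [div_mul_eq_mul_div, le_div_iff₀ hz]
    gcongr
  rw [norm_inv, mul_one_div, inv_eq_one_div, div_le_div_iff₀ hpos (by linarith)]
  linarith

theorem integrableOn_inv_ofReal_add {Ψ : ℝ → ℝ} (hmono : MonotoneOn Ψ (Ioi 0))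
    (hnonneg : ∀ ζ ∈ Ioi (0:ℝ), 0 ≤ Ψ ζ)
    (hint : IntegrableOn (fun ζ => 1 / (1 + Ψ ζ)) (Ioi 0)) {z : ℂ} (hz : 0 < z.im) :
    IntegrableOn (fun ζ => ((Ψ ζ : ℂ) + z)⁻¹) (Ioi 0) := by
  have hmeas : AEMeasurable Ψ (volume.restrict (Ioi 0)) :=
    aemeasurable_restrict_of_monotoneOn measurableSet_Ioi hmono
  refine (hint.const_mul (1 + ‖1 - z‖ / z.im)).mono'
    ((Complex.measurable_ofReal.comp_aemeasurable hmeas).add_const z).inv.aestronglyMeasurable ?_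
  filter_upwards [ae_restrict_mem measurableSet_Ioi] with ζ hζ
  exact norm_inv_ofReal_add_le (hnonneg ζ hζ) hz

theorem im_inv_pi_mul_setIntegral {s : Set ℝ} {k : ℝ → ℝ} {q : ℝ → ℂ}
    (h : IntegrableOn (fun ζ => (k ζ : ℂ) * q ζ) s) :
    ((Real.pi : ℂ)⁻¹ * ∫ ζ in s, (k ζ : ℂ) * q ζ).im =
      -(Real.pi⁻¹ * ∫ ζ in s, k ζ * -(q ζ).im) := by
  rw [← Complex.ofReal_inv, Complex.im_ofReal_mul, ← Complex.imCLM_apply,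
    ← Complex.imCLM.integral_comp_comm h]
  simp [integral_neg]

theorem antitoneOn_sq_div_sq_add_sq {ξ : ℝ} (hξ : 0 < ξ) :
    AntitoneOn (fun ζ => ξ ^ 2 / (ξ ^ 2 + ζ ^ 2)) (Ioi 0) := by
  intro x hx y _ hxy
  have hx' : 0 ≤ x := le_of_lt hx
  dsimp only
  gcongr

theorem norm_sq_div_sq_add_sq_le_one (ξ ζ : ℝ) : ‖ξ ^ 2 / (ξ ^ 2 + ζ ^ 2)‖ ≤ 1 := by
  rw [Real.norm_of_nonneg (by positivity)]
  exact div_le_one_of_le₀ (by linarith [sq_nonneg ζ]) (by positivity)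

theorem im_products_nonpos (Ψ : ℝ → ℝ)
    (hmono : StrictMonoOn Ψ (Ioi 0))
    (hnonneg : ∀ ζ ∈ Ioi (0:ℝ), 0 ≤ Ψ ζ)
    (hint : IntegrableOn (fun ζ => 1 / (1 + Ψ ζ)) (Ioi 0))
    (ξ₁ ξ₂ : ℝ) (hξ₁ : 0 < ξ₁) (hξ₂ : 0 < ξ₂) (z : ℂ) (hz : 0 < z.im) :
    (phi1 Ψ ξ₁ z).im * (phi1 Ψ ξ₂ z).im - (phi Ψ z).im * (phi2 Ψ ξ₁ ξ₂ z).im ≤ 0 := by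
  have hq := integrableOn_inv_ofReal_add hmono.monotoneOn hnonneg hint hz
  set q : ℝ → ℂ := fun ζ => ((Ψ ζ : ℂ) + z)⁻¹ with hq_def
  have hw₀ : ∀ ζ ∈ Ioi (0:ℝ), 0 ≤ -(q ζ).im := by
    intro ζ _
    rw [hq_def]
    simp only [Complex.inv_im, Complex.add_im, Complex.ofReal_im, zero_add, neg_div, neg_neg]
    exact div_nonneg hz.le (Complex.normSq_nonneg _)
  have weighted : ∀ k : ℝ → ℝ, Measurable k → (∀ ζ, ‖k ζ‖ ≤ 1) →
      IntegrableOn (fun ζ => (k ζ : ℂ) * q ζ) (Ioi 0) := by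
    intro k hk hk₁
    refine hq.bdd_mul (c := 1) (Complex.measurable_ofReal.comp hk).aestronglyMeasurable ?_
    exact ae_of_all _ fun ζ => by simpa using hk₁ ζ
  have weighted_im : ∀ k : ℝ → ℝ, IntegrableOn (fun ζ => (k ζ : ℂ) * q ζ) (Ioi 0) →
      IntegrableOn (fun ζ => k ζ * -(q ζ).im) (Ioi 0) := by
    intro k hk
    refine hk.im.neg.congr (ae_of_all _ fun ζ => ?_)
    simp
  set f : ℝ → ℝ → ℝ := fun ξ ζ => ξ ^ 2 / (ξ ^ 2 + ζ ^ 2) with hf_def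
  have hf_meas : ∀ ξ, Measurable (f ξ) := fun ξ => by fun_prop
  have hf_le : ∀ ξ ζ, ‖f ξ ζ‖ ≤ 1 := norm_sq_div_sq_add_sq_le_one
  have h₀ := weighted (fun _ => 1) measurable_const (by simp)
  have h₁ := weighted (f ξ₁) (hf_meas ξ₁) (hf_le ξ₁)
  have h₂ := weighted (f ξ₂) (hf_meas ξ₂) (hf_le ξ₂)
  have h₁₂ := weighted (fun ζ => f ξ₁ ζ * f ξ₂ ζ) ((hf_meas ξ₁).mul (hf_meas ξ₂)) fun ζ => by
    rw [norm_mul]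
    exact mul_le_one₀ (hf_le ξ₁ ζ) (norm_nonneg _) (hf_le ξ₂ ζ)
  have key := setIntegral_mul_setIntegral_le_of_monovaryOn measurableSet_Ioi
    ((antitoneOn_sq_div_sq_add_sq hξ₁).monovaryOn (antitoneOn_sq_div_sq_add_sq hξ₂)) hw₀
    (by simpa using weighted_im _ h₀) (weighted_im _ h₁) (weighted_im _ h₂) (weighted_im _ h₁₂)
  have e₀ := im_inv_pi_mul_setIntegral h₀
  simp only [Complex.ofReal_one, one_mul] at e₀
  have e₁ : (phi1 Ψ ξ₁ z).im = _ := im_inv_pi_mul_setIntegral h₁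
  have e₂ : (phi1 Ψ ξ₂ z).im = _ := im_inv_pi_mul_setIntegral h₂
  have e₁₂ : (phi2 Ψ ξ₁ ξ₂ z).im = _ := im_inv_pi_mul_setIntegral h₁₂
  change (phi Ψ z).im = _ at e₀
  rw [e₀, e₁, e₂, e₁₂]
  have hpi := mul_le_mul_of_nonneg_left key (sq_nonneg Real.pi⁻¹)
  linarith
end

section
/- Assume Ψ : (0,∞) → [0,∞) is strictly increasing, twice continuously differentiable with Ψ'(ζ) > 0 for all ζ > 0, and ∫₀^∞ 1/(1+Ψ(ζ)) dζ < ∞. Then for every λ > 0, the function u ↦ 2λ/(λ²−u²) − Ψ'(λ)/(Ψ(λ)−Ψ(u)) (defined for u ∈ (0,∞), u ≠ λ) is Lebesgue integrable on (0,∞) and ∫₀^∞ (2λ/(λ²−u²) − Ψ'(λ)/(Ψ(λ)−Ψ(u))) du = π K_λ. Consequently, with ϑ_λ = arctan K_λ, one has (cos ϑ_λ/π) ∫₀^∞ (2λ/(λ²−u²) − Ψ'(λ)/(Ψ(λ)−Ψ(u))) du = sin ϑ_λ. -/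
open MeasureTheory Filter Topology Set

/-- A strictly increasing function stays, away from `lam`, at a distance from its value at `lam`
comparable to `1 + Ψ`. -/
lemma StrictMonoOn.exists_mul_one_add_le_abs_sub {Ψ : ℝ → ℝ} (hmono : StrictMonoOn Ψ (Ioi 0))
    (hnonneg : ∀ ζ ∈ Ioi (0:ℝ), 0 ≤ Ψ ζ) {lam δ : ℝ} (hlam : 0 < lam) (hδ : 0 < δ) :
    ∃ k > 0, ∀ u ∈ Ioi (0:ℝ) \ Icc (lam - δ) (lam + δ), k * (1 + Ψ u) ≤ |Ψ lam - Ψ u| := by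
  obtain ⟨d, hd0, hdδ, hdl⟩ : ∃ d > 0, d ≤ δ ∧ d < lam :=
    ⟨min δ (lam / 2), by positivity, min_le_left _ _, (min_le_right _ _).trans_lt (by linarith)⟩
  have hl : lam - d ∈ Ioi (0:ℝ) := by simpa using hdl
  have hr : lam + d ∈ Ioi (0:ℝ) := mem_Ioi.2 (by linarith)
  have h1 : Ψ (lam - d) < Ψ lam := hmono hl hlam (by linarith)
  have h2 : Ψ lam < Ψ (lam + d) := hmono hlam hr (by linarith)
  have h0 := hnonneg lam hlam
  have hk1 : 0 < (Ψ lam - Ψ (lam - d)) / (1 + Ψ lam) := div_pos (by linarith) (by linarith)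
  have hk2 : 0 < (Ψ (lam + d) - Ψ lam) / (1 + Ψ (lam + d)) := div_pos (by linarith) (by linarith)
  refine ⟨_, lt_min hk1 hk2, fun u ⟨hu, hu'⟩ => ?_⟩
  have hu0 := hnonneg u hu
  rcases lt_or_ge u (lam - δ) with h | h
  · have h3 : Ψ u ≤ Ψ (lam - d) := hmono.monotoneOn hu hl (by linarith)
    calc _ ≤ (Ψ lam - Ψ (lam - d)) / (1 + Ψ lam) * (1 + Ψ lam) :=
          mul_le_mul (min_le_left _ _) (by linarith) (by linarith) hk1.le
      _ = Ψ lam - Ψ (lam - d) := div_mul_cancel₀ _ (by linarith)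
      _ ≤ Ψ lam - Ψ u := by linarith
      _ ≤ _ := le_abs_self _
  · have h4 : lam + δ < u := by
      by_contra hc
      exact hu' ⟨h, not_lt.1 hc⟩
    have h3 : Ψ (lam + d) ≤ Ψ u := hmono.monotoneOn hr hu (by linarith)
    calc _ ≤ (Ψ (lam + d) - Ψ lam) / (1 + Ψ (lam + d)) * (1 + Ψ u) :=
          mul_le_mul_of_nonneg_right (min_le_right _ _) (by linarith)
      _ ≤ Ψ u - Ψ lam := by
          rw [div_mul_eq_mul_div, div_le_iff₀ (by linarith)]
          nlinarith [mul_nonneg (sub_nonneg.2 h3) (by linarith : 0 ≤ 1 + Ψ lam)]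
      _ ≤ _ := by rw [abs_sub_comm]; exact le_abs_self _

lemma integrableOn_div_sub_diff_Icc {Ψ : ℝ → ℝ} (hmono : StrictMonoOn Ψ (Ioi 0))
    (hnonneg : ∀ ζ ∈ Ioi (0:ℝ), 0 ≤ Ψ ζ) (hcont : ContinuousOn Ψ (Ioi 0))
    (hint : IntegrableOn (fun ζ => 1 / (1 + Ψ ζ)) (Ioi 0)) (c : ℝ)
    {lam δ : ℝ} (hlam : 0 < lam) (hδ : 0 < δ) :
    IntegrableOn (fun u => c / (Ψ lam - Ψ u)) (Ioi (0:ℝ) \ Icc (lam - δ) (lam + δ)) := by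
  obtain ⟨k, hk, hb⟩ := hmono.exists_mul_one_add_le_abs_sub hnonneg hlam hδ
  have hmeas : MeasurableSet (Ioi (0:ℝ) \ Icc (lam - δ) (lam + δ)) :=
    measurableSet_Ioi.diff measurableSet_Icc
  refine Integrable.mono' ((hint.mono_set sdiff_subset).const_mul (|c| / k)) ?_ ?_
  · have h1 : AEMeasurable Ψ (volume.restrict (Ioi (0:ℝ) \ Icc (lam - δ) (lam + δ))) :=
      (hcont.mono sdiff_subset).aemeasurable hmeas
    exact ((h1.const_sub _).const_div _).aestronglyMeasurable
  · refine (ae_restrict_iff' hmeas).2 (Eventually.of_forall fun u hu => ?_)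
    have h0 := hnonneg u hu.1
    have hp : 0 < k * (1 + Ψ u) := by positivity
    rw [Real.norm_eq_abs, abs_div, div_mul_div_comm, mul_one]
    exact div_le_div_of_nonneg_left (abs_nonneg _) hp (hb u hu)

/-- The kernel `Ψ' lam / (Ψ lam - Ψ u)` has the same singular part as `1 / (lam - u)`. -/
lemma exists_abs_inv_sub_sub_div_sub_le {Ψ Ψ' : ℝ → ℝ} {lam b : ℝ}
    (h1 : ∀ᶠ u in 𝓝 lam, HasDerivAt Ψ (Ψ' u) u) (h2 : HasDerivAt Ψ' b lam)
    (hpos : 0 < Ψ' lam) :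
    ∃ C, ∀ᶠ u in 𝓝 lam, |1 / (lam - u) - Ψ' lam / (Ψ lam - Ψ u)| ≤ C := by
  obtain ⟨M, hM0, hM⟩ := h2.differentiableAt.isBigO_sub.exists_pos
  replace hM := hM.bound
  have hlow : ∀ᶠ u in 𝓝 lam, |Ψ u - Ψ lam - (u - lam) * Ψ' lam| ≤ Ψ' lam / 2 * |u - lam| := by
    have := (hasDerivAt_iff_isLittleO.1 h1.self_of_nhds).bound (half_pos hpos)
    simpa using this
  obtain ⟨δ, hδ, hball⟩ := Metric.eventually_nhds_iff_ball.1 (h1.and (hM.and hlow))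
  refine ⟨2 * M / Ψ' lam, Metric.eventually_nhds_iff_ball.2 ⟨δ, hδ, fun u hu => ?_⟩⟩
  rcases eq_or_ne u lam with rfl | hne
  · rw [sub_self, sub_self, div_zero, div_zero, sub_self, abs_zero]
    positivity
  have hd : 0 < |u - lam| := abs_pos.2 (sub_ne_zero.2 hne)
  have hseg : ∀ v ∈ uIcc lam u, v ∈ Metric.ball lam δ ∧ |v - lam| ≤ |u - lam| := fun v hv => by
    have := abs_sub_left_of_mem_uIcc hv
    refine ⟨?_, this⟩
    rw [Metric.mem_ball, Real.dist_eq] at hu ⊢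
    exact this.trans_lt hu
  have hnum : |Ψ u - Ψ lam - (u - lam) * Ψ' lam| ≤ M * |u - lam| * |u - lam| := by
    have := (convex_uIcc lam u).norm_image_sub_le_of_norm_hasDerivWithin_le
      (f := fun v => Ψ v - v * Ψ' lam) (f' := fun v => Ψ' v - Ψ' lam) (C := M * |u - lam|)
      (fun v hv => by
        have := (hball v (hseg v hv).1).1.fun_sub ((hasDerivAt_id' v).mul_const (Ψ' lam))
        rw [one_mul] at this
        exact this.hasDerivWithinAt)
      (fun v hv => by
        refine (hball v (hseg v hv).1).2.1.trans ?_
        exact mul_le_mul_of_nonneg_left (hseg v hv).2 hM0.le)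
      left_mem_uIcc right_mem_uIcc
    simp only [Real.norm_eq_abs] at this
    convert this using 2
    ring
  have hden : Ψ' lam / 2 * |u - lam| ≤ |Ψ u - Ψ lam| := by
    have h := (hball u hu).2.2
    have h' := abs_sub_abs_le_abs_sub ((u - lam) * Ψ' lam) (Ψ u - Ψ lam)
    rw [abs_sub_comm ((u - lam) * Ψ' lam), abs_mul, abs_of_pos hpos] at h'
    linarith
  have hden0 : 0 < |Ψ u - Ψ lam| := lt_of_lt_of_le (by positivity) hden
  have e : 1 / (lam - u) - Ψ' lam / (Ψ lam - Ψ u)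
      = (Ψ u - Ψ lam - (u - lam) * Ψ' lam) / ((u - lam) * (Ψ lam - Ψ u)) := by
    have ha : lam - u ≠ 0 := sub_ne_zero.2 hne.symm
    have ha' : u - lam ≠ 0 := sub_ne_zero.2 hne
    have hb : Ψ lam - Ψ u ≠ 0 := sub_ne_zero.2 (sub_ne_zero.1 (abs_pos.1 hden0)).symm
    rw [← neg_sub u lam]
    field_simp
    ring
  rw [e, abs_div, abs_mul, abs_sub_comm (Ψ lam), div_le_div_iff₀ (by positivity) hpos]
  calc _ ≤ M * |u - lam| * |u - lam| * Ψ' lam := by gcongr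
    _ = 2 * M * (|u - lam| * (Ψ' lam / 2 * |u - lam|)) := by ring
    _ ≤ _ := by gcongr

lemma integral_two_mul_div_sq_sub_sq_diff_Icc {lam ε : ℝ} (hlam : 0 < lam) (hε : 0 < ε)
    (hεl : ε < lam)
    (hint : IntegrableOn (fun u => 2 * lam / (lam ^ 2 - u ^ 2))
      (Ioi (0:ℝ) \ Icc (lam - ε) (lam + ε))) :
    ∫ u in Ioi (0:ℝ) \ Icc (lam - ε) (lam + ε), 2 * lam / (lam ^ 2 - u ^ 2)
      = Real.log (2 * lam - ε) - Real.log (2 * lam + ε) := by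
  have hset : Ioi (0:ℝ) \ Icc (lam - ε) (lam + ε) = Ioo 0 (lam - ε) ∪ Ioi (lam + ε) := by
    ext u
    simp only [Set.mem_sdiff, mem_Ioi, mem_Icc, mem_union, mem_Ioo, not_and, not_le]
    constructor
    · rintro ⟨h0, h⟩
      rcases lt_or_ge u (lam - ε) with h' | h'
      · exact Or.inl ⟨h0, h'⟩
      · exact Or.inr (h h')
    · rintro (⟨h0, h⟩ | h)
      · exact ⟨h0, fun h' => by linarith⟩
      · exact ⟨by linarith, fun _ => h⟩
  have hder : ∀ u, 0 ≤ u → u ≠ lam → HasDerivAt (fun u => Real.log (lam + u) - Real.log (lam - u))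
      (2 * lam / (lam ^ 2 - u ^ 2)) u := by
    intro u hu hne
    have ha : lam + u ≠ 0 := by positivity
    have hb : lam - u ≠ 0 := sub_ne_zero.2 hne.symm
    have hval : 1 / (lam + u) - -1 / (lam - u) = 2 * lam / (lam ^ 2 - u ^ 2) := by
      rw [sq_sub_sq]
      field_simp
      ring
    rw [← hval]
    exact (((hasDerivAt_id' u).const_add lam).log ha).fun_sub
      (((hasDerivAt_id' u).const_sub lam).log hb)
  rw [hset] at hint ⊢
  have hl := hint.mono_set subset_union_left
  have hr := hint.mono_set subset_union_right
  rw [setIntegral_union (by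
    refine disjoint_left.2 fun u hu hu' => ?_
    have := hu.2
    have := mem_Ioi.1 hu'
    linarith) measurableSet_Ioi hl hr]
  have hlim : Tendsto (fun u => Real.log (lam + u) - Real.log (lam - u)) atTop (𝓝 0) := by
    have h1 := Real.tendsto_log_comp_add_sub_log lam
    have h2 := Real.tendsto_log_comp_add_sub_log (-lam)
    have h3 := h1.sub h2
    rw [sub_zero] at h3
    refine h3.congr fun u => ?_
    rw [← Real.log_neg_eq_log (lam - u), add_comm u lam, neg_sub, ← sub_eq_add_neg]
    ring
  rw [integral_Ioi_of_hasDerivAt_of_tendsto' (fun u hu => hder u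
      (by linarith [mem_Ici.1 hu]) (by linarith [mem_Ici.1 hu] : lam < u).ne') hr hlim,
    ← integral_Ioc_eq_integral_Ioo, ← intervalIntegral.integral_of_le (by linarith),
    intervalIntegral.integral_eq_sub_of_hasDerivAt (fun u hu => by
      rw [uIcc_of_le (by linarith)] at hu
      exact hder u hu.1 (by linarith [hu.2] : u < lam).ne)
      (by
        rw [intervalIntegrable_iff_integrableOn_Ioo_of_le (by linarith)]
        exact hl)]
  have e1 : lam + (lam - ε) = 2 * lam - ε := by ring
  have e2 : lam - (lam - ε) = ε := by ring
  have e3 : lam + (lam + ε) = 2 * lam + ε := by ring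
  have e4 : lam - (lam + ε) = -ε := by ring
  rw [e1, e2, e3, e4, Real.log_neg_eq_log, add_zero, sub_zero]
  ring

lemma tendsto_setIntegral_diff_Icc {f : ℝ → ℝ} {s : Set ℝ} (hf : IntegrableOn f s) (a : ℝ) :
    Tendsto (fun ε : ℝ => ∫ u in s \ Icc (a - ε) (a + ε), f u) (𝓝[>] 0) (𝓝 (∫ u in s, f u)) := by
  have hz : Tendsto (fun ε : ℝ => ∫ u in Icc (a - ε) (a + ε), f u ∂(volume.restrict s))
      (𝓝[>] 0) (𝓝 0) := by
    refine hf.integrable.tendsto_setIntegral_nhds_zero ?_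
    refine tendsto_of_tendsto_of_tendsto_of_le_of_le tendsto_const_nhds
      (h := fun ε => ENNReal.ofReal (2 * ε)) ?_ (fun _ => zero_le) (fun ε => ?_)
    · have : Tendsto (fun ε : ℝ => ENNReal.ofReal (2 * ε)) (𝓝 0) (𝓝 (ENNReal.ofReal (2 * 0))) :=
        (ENNReal.continuous_ofReal.comp (continuous_const.mul continuous_id)).tendsto 0
      rw [mul_zero, ENNReal.ofReal_zero] at this
      exact this.mono_left nhdsWithin_le_nhds
    · refine (Measure.restrict_apply_le _ _).trans ?_
      rw [Real.volume_Icc]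
      exact ENNReal.ofReal_le_ofReal (by linarith)
  have h := tendsto_const_nhds (x := ∫ u in s, f u) (f := 𝓝[>] (0:ℝ)) |>.sub hz
  rw [sub_zero] at h
  refine h.congr fun ε => ?_
  rw [Measure.restrict_restrict measurableSet_Icc, inter_comm, sub_eq_iff_eq_add, add_comm]
  exact (integral_inter_add_sdiff measurableSet_Icc hf).symm

theorem F_lambda_vanishes_at_zero (Ψ Ψ' Ψ'' : ℝ → ℝ)
    (hmono : StrictMonoOn Ψ (Ioi 0))
    (hnonneg : ∀ ζ ∈ Ioi (0:ℝ), 0 ≤ Ψ ζ)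
    (hΨd1 : ∀ ζ ∈ Ioi (0:ℝ), HasDerivAt Ψ (Ψ' ζ) ζ)
    (hΨd2 : ∀ ζ ∈ Ioi (0:ℝ), HasDerivAt Ψ' (Ψ'' ζ) ζ)
    (hΨ''cont : ContinuousOn Ψ'' (Ioi 0))
    (hΨ'pos : ∀ ζ ∈ Ioi (0:ℝ), 0 < Ψ' ζ)
    (hint : IntegrableOn (fun ζ => 1 / (1 + Ψ ζ)) (Ioi 0))
    (lam : ℝ) (hlam : 0 < lam)
    (Kl : ℝ)
    (hKl : Tendsto (fun ε : ℝ =>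
        -(Real.pi)⁻¹ * ∫ ζ in Ioi (0:ℝ) \ Icc (lam - ε) (lam + ε),
          Ψ' lam / (Ψ lam - Ψ ζ))
      (𝓝[>] 0) (𝓝 Kl)) :
    IntegrableOn
        (fun u => 2 * lam / (lam^2 - u^2) - Ψ' lam / (Ψ lam - Ψ u)) (Ioi 0) ∧
      (∫ u in Ioi (0:ℝ), (2 * lam / (lam^2 - u^2) - Ψ' lam / (Ψ lam - Ψ u)))
        = Real.pi * Kl ∧
      (Real.cos (Real.arctan Kl) / Real.pi) *
          ∫ u in Ioi (0:ℝ), (2 * lam / (lam^2 - u^2) - Ψ' lam / (Ψ lam - Ψ u))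
        = Real.sin (Real.arctan Kl) := by
  have hcont : ContinuousOn Ψ (Ioi 0) := fun ζ hζ => (hΨd1 ζ hζ).continuousAt.continuousWithinAt
  have hfar {δ : ℝ} (hδ : 0 < δ) := integrableOn_div_sub_diff_Icc hmono hnonneg hcont hint
    (Ψ' lam) hlam hδ
  have hfar_sq {δ : ℝ} (hδ : 0 < δ) :
      IntegrableOn (fun u => 2 * lam / (lam ^ 2 - u ^ 2))
        (Ioi (0:ℝ) \ Icc (lam - δ) (lam + δ)) :=
    integrableOn_div_sub_diff_Icc (Ψ := fun u => u ^ 2)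
      (fun x hx y _ hxy => pow_lt_pow_left₀ hxy (mem_Ioi.1 hx).le two_ne_zero)
      (fun _ _ => sq_nonneg _) (by fun_prop)
      (by simpa using integrable_inv_one_add_sq.integrableOn) (2 * lam) hlam hδ
  have hI : IntegrableOn
      (fun u => 2 * lam / (lam^2 - u^2) - Ψ' lam / (Ψ lam - Ψ u)) (Ioi 0) := by
    obtain ⟨C₁, h₁⟩ := exists_abs_inv_sub_sub_div_sub_le
      (eventually_of_mem (Ioi_mem_nhds hlam) hΨd1) (hΨd2 lam hlam) (hΨ'pos lam hlam)
    obtain ⟨C₂, h₂⟩ := exists_abs_inv_sub_sub_div_sub_le (Ψ := fun u => u ^ 2)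
      (Ψ' := fun u => 2 * u) (lam := lam) (b := 2)
      (Eventually.of_forall fun u => by simpa using hasDerivAt_pow 2 u)
      (by simpa using (hasDerivAt_id lam).const_mul (2:ℝ)) (by positivity)
    obtain ⟨δ, hδ, hb⟩ := Metric.nhds_basis_closedBall.eventually_iff.1 (h₁.and h₂)
    rw [Real.closedBall_eq_Icc] at hb
    rw [← sdiff_union_inter (Ioi (0:ℝ)) (Icc (lam - δ) (lam + δ))]
    refine ((hfar_sq hδ).sub (hfar hδ)).union ?_
    have hfin : volume (Ioi (0:ℝ) ∩ Icc (lam - δ) (lam + δ)) < ⊤ :=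
      (measure_mono inter_subset_right).trans_lt measure_Icc_lt_top
    have hmeas : MeasurableSet (Ioi (0:ℝ) ∩ Icc (lam - δ) (lam + δ)) :=
      measurableSet_Ioi.inter measurableSet_Icc
    refine IntegrableOn.of_bound hfin ?_ (C₁ + C₂) ?_
    · have hΨm : AEMeasurable Ψ (volume.restrict (Ioi (0:ℝ) ∩ Icc (lam - δ) (lam + δ))) :=
        (hcont.mono inter_subset_left).aemeasurable hmeas
      have hq : Measurable fun u : ℝ => 2 * lam / (lam ^ 2 - u ^ 2) := by fun_prop
      exact (hq.aemeasurable.sub ((hΨm.const_sub _).const_div _)).aestronglyMeasurable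
    · refine (ae_restrict_iff' hmeas).2 (Eventually.of_forall fun u hu => ?_)
      obtain ⟨hb₁, hb₂⟩ := hb hu.2
      rw [abs_le] at hb₁ hb₂
      rw [Pi.sub_apply, Real.norm_eq_abs, abs_le]
      constructor <;> linarith [hb₁.1, hb₁.2, hb₂.1, hb₂.2]
  have hzero : Tendsto (fun ε : ℝ => ∫ u in Ioi (0:ℝ) \ Icc (lam - ε) (lam + ε),
      2 * lam / (lam ^ 2 - u ^ 2)) (𝓝[>] 0) (𝓝 0) := by
    have hc : ContinuousAt (fun ε : ℝ => Real.log (2 * lam - ε) - Real.log (2 * lam + ε)) 0 := by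
      refine ContinuousAt.sub (ContinuousAt.log (by fun_prop) ?_)
        (ContinuousAt.log (by fun_prop) ?_) <;> simpa using hlam.ne'
    have ht := hc.tendsto
    rw [sub_zero, add_zero, sub_self] at ht
    refine (ht.mono_left nhdsWithin_le_nhds).congr' ?_
    filter_upwards [Ioo_mem_nhdsGT hlam] with ε hε
    exact (integral_two_mul_div_sq_sub_sq_diff_Icc hlam hε.1 hε.2 (hfar_sq hε.1)).symm
  have heq : (∫ u in Ioi (0:ℝ), (2 * lam / (lam^2 - u^2) - Ψ' lam / (Ψ lam - Ψ u)))
      = Real.pi * Kl := by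
    refine tendsto_nhds_unique (tendsto_setIntegral_diff_Icc hI lam) ?_
    have ht := hzero.add (hKl.const_mul Real.pi)
    rw [zero_add] at ht
    refine ht.congr' ?_
    filter_upwards [self_mem_nhdsWithin] with ε hε
    rw [integral_sub (hfar_sq hε) (hfar hε)]
    field_simp [Real.pi_ne_zero]
    ring
  refine ⟨hI, heq, ?_⟩
  rw [heq, ← Real.tan_mul_cos (Real.cos_arctan_pos Kl).ne', Real.tan_arctan]
  field_simp [Real.pi_ne_zero]
end
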